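/- For n ≥ 3, the diffeomorphism Φ of ℝ^{2n} defined by Φ(q_1,…,q_n,p_1,…,p_n) = (q_1,…,q_n, p_1+e^{−q_1}, p_2,…,p_{n−1}, p_n+e^{q_n}) preserves the canonical bracket ({F∘Φ, G∘Φ}_0 = {F,G}_0∘Φ for all smooth F, G), and the pushforward of the second Toda bracket under Φ, defined by {F,G}'_1(Φ(z)) := {F∘Φ, G∘Φ}_1(z), has the same elementary brackets as {.,.}_1 except: {q_i, p_1}'_1 = p_1δ_{i1} − e^{−q_1} and {q_i, p_n}'_1 = p_nδ_{in} − e^{q_n} for every i = 1,…,n, and {p_1, p_n}'_1 = e^{q_n−q_1}. -/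

import Mathlib

noncomputable section

/-- Partial derivative of `F` with respect to `q_i` on
`ℝ^{2n} = (Fin n → ℝ) × (Fin n → ℝ)`, coordinates `(q, p)`. -/
def pdQ {n : ℕ} (F : (Fin n → ℝ) × (Fin n → ℝ) → ℝ) (i : Fin n)
    (z : (Fin n → ℝ) × (Fin n → ℝ)) : ℝ :=
  fderiv ℝ F z (Pi.single i 1, 0)

/-- Partial derivative of `F` with respect to `p_i`. -/
def pdP {n : ℕ} (F : (Fin n → ℝ) × (Fin n → ℝ) → ℝ) (i : Fin n)
    (z : (Fin n → ℝ) × (Fin n → ℝ)) : ℝ :=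
  fderiv ℝ F z (0, Pi.single i 1)

/-- The canonical bracket `{F,G}_0 := Σ_i (∂F/∂q_i ∂G/∂p_i − ∂F/∂p_i ∂G/∂q_i)`. -/
def todaBr0 {n : ℕ} (F G : (Fin n → ℝ) × (Fin n → ℝ) → ℝ)
    (z : (Fin n → ℝ) × (Fin n → ℝ)) : ℝ :=
  ∑ i, (pdQ F i z * pdP G i z - pdP F i z * pdQ G i z)

/-- The second (open) Toda bracket
`{F,G}_1 := Σ_{i=1}^{n−1} e^{q_i−q_{i+1}} (∂F/∂p_{i+1} ∂G/∂p_i − ∂F/∂p_i ∂G/∂p_{i+1})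
 + Σ_i p_i (∂F/∂q_i ∂G/∂p_i − ∂F/∂p_i ∂G/∂q_i)
 + Σ_{i<j} (∂F/∂q_j ∂G/∂q_i − ∂F/∂q_i ∂G/∂q_j)`. -/
def todaBr1 {n : ℕ} (F G : (Fin n → ℝ) × (Fin n → ℝ) → ℝ)
    (z : (Fin n → ℝ) × (Fin n → ℝ)) : ℝ :=
  (∑ i : Fin n, ∑ j : Fin n, if (i : ℕ) + 1 = (j : ℕ) then
      Real.exp (z.1 i - z.1 j) * (pdP F j z * pdP G i z - pdP F i z * pdP G j z) else 0)
  + (∑ i : Fin n, z.2 i * (pdQ F i z * pdP G i z - pdP F i z * pdQ G i z))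
  + (∑ i : Fin n, ∑ j : Fin n, if i < j then
      (pdQ F j z * pdQ G i z - pdQ F i z * pdQ G j z) else 0)

/-- The map `Φ(q,p) = (q, p₁+e^{−q₁}, p₂, …, p_{n−1}, p_n+e^{q_n})` (indices written
`0, …, n−1` in Lean, so `p_1` is index `0` and `p_n` is index `n−1`). -/
def Phi (n : ℕ) (z : (Fin n → ℝ) × (Fin n → ℝ)) : (Fin n → ℝ) × (Fin n → ℝ) :=
  (z.1, fun i => z.2 i + (if (i : ℕ) = 0 then Real.exp (-(z.1 i)) else 0)
    + (if (i : ℕ) = n - 1 then Real.exp (z.1 i) else 0))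

/-- Coordinate function `q_i`. -/
def Qc {n : ℕ} (i : Fin n) (z : (Fin n → ℝ) × (Fin n → ℝ)) : ℝ := z.1 i

/-- Coordinate function `p_i`. -/
def Pc {n : ℕ} (i : Fin n) (z : (Fin n → ℝ) × (Fin n → ℝ)) : ℝ := z.2 i

/-- The partial derivative with respect to `q_i` of the `p_i` component of `Phi`. -/
def shiftDeriv {n : ℕ} (q : Fin n → ℝ) (i : Fin n) : ℝ :=
  (if (i : ℕ) = 0 then -Real.exp (-(q i)) else 0) + (if (i : ℕ) = n - 1 then Real.exp (q i) else 0)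

theorem hasFDerivAt_Qc {n : ℕ} (i : Fin n) (z : (Fin n → ℝ) × (Fin n → ℝ)) :
    HasFDerivAt (Qc i) ((ContinuousLinearMap.proj i).comp
      (ContinuousLinearMap.fst ℝ (Fin n → ℝ) (Fin n → ℝ))) z :=
  ((ContinuousLinearMap.proj (R := ℝ) (φ := fun _ : Fin n => ℝ) i).comp
    (ContinuousLinearMap.fst ℝ (Fin n → ℝ) (Fin n → ℝ))).hasFDerivAt

theorem hasFDerivAt_Pc {n : ℕ} (i : Fin n) (z : (Fin n → ℝ) × (Fin n → ℝ)) :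
    HasFDerivAt (Pc i) ((ContinuousLinearMap.proj i).comp
      (ContinuousLinearMap.snd ℝ (Fin n → ℝ) (Fin n → ℝ))) z :=
  ((ContinuousLinearMap.proj (R := ℝ) (φ := fun _ : Fin n => ℝ) i).comp
    (ContinuousLinearMap.snd ℝ (Fin n → ℝ) (Fin n → ℝ))).hasFDerivAt

theorem hasFDerivAt_Phi {n : ℕ} (z : (Fin n → ℝ) × (Fin n → ℝ)) :
    HasFDerivAt (Phi n)
      ((ContinuousLinearMap.fst ℝ (Fin n → ℝ) (Fin n → ℝ)).prod
        (ContinuousLinearMap.pi fun i =>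
          (ContinuousLinearMap.proj i).comp (ContinuousLinearMap.snd ℝ (Fin n → ℝ) (Fin n → ℝ)) +
          shiftDeriv z.1 i • (ContinuousLinearMap.proj i).comp
            (ContinuousLinearMap.fst ℝ (Fin n → ℝ) (Fin n → ℝ)))) z := by
  refine HasFDerivAt.prodMk hasFDerivAt_fst (hasFDerivAt_pi.2 fun i => ?_)
  have hshift : HasDerivAt (fun t : ℝ => (if (i : ℕ) = 0 then Real.exp (-t) else 0) +
      (if (i : ℕ) = n - 1 then Real.exp t else 0)) (shiftDeriv z.1 i) (z.1 i) := by
    refine HasDerivAt.add ?_ ?_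
    · split_ifs
      · simpa using (hasDerivAt_neg (z.1 i)).exp
      · exact hasDerivAt_const _ _
    · split_ifs
      · exact Real.hasDerivAt_exp _
      · exact hasDerivAt_const _ _
  simp only [add_assoc]
  have h := (hasFDerivAt_Pc i z).add (hshift.comp_hasFDerivAt z (hasFDerivAt_Qc i z))
  exact h

theorem pdQ_comp_Phi {n : ℕ} {F : (Fin n → ℝ) × (Fin n → ℝ) → ℝ} (hF : Differentiable ℝ F)
    (i : Fin n) (z : (Fin n → ℝ) × (Fin n → ℝ)) :
    pdQ (F ∘ Phi n) i z = pdQ F i (Phi n z) + shiftDeriv z.1 i * pdP F i (Phi n z) := by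
  have h := ((hF (Phi n z)).hasFDerivAt.comp z (hasFDerivAt_Phi z)).fderiv
  rw [pdQ, h, pdQ, pdP, ← smul_eq_mul, ← map_smul, ← map_add]
  refine congrArg (fderiv ℝ F (Phi n z)) (Prod.ext (by simp) (funext fun j => ?_))
  obtain rfl | hj := eq_or_ne j i <;> simp [*]

theorem pdP_comp_Phi {n : ℕ} {F : (Fin n → ℝ) × (Fin n → ℝ) → ℝ} (hF : Differentiable ℝ F)
    (i : Fin n) (z : (Fin n → ℝ) × (Fin n → ℝ)) :
    pdP (F ∘ Phi n) i z = pdP F i (Phi n z) := by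
  have h := ((hF (Phi n z)).hasFDerivAt.comp z (hasFDerivAt_Phi z)).fderiv
  rw [pdP, h, pdP]
  exact congrArg (fderiv ℝ F (Phi n z)) (Prod.ext (by simp) (funext fun j => by simp))

theorem pdQ_Qc_comp_Phi {n : ℕ} (i j : Fin n) (z : (Fin n → ℝ) × (Fin n → ℝ)) :
    pdQ (Qc j ∘ Phi n) i z = if i = j then 1 else 0 := by
  rw [pdQ_comp_Phi fun w => (hasFDerivAt_Qc j w).differentiableAt]
  simp [pdQ, pdP, (hasFDerivAt_Qc j _).fderiv, Pi.single_apply, eq_comm]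

theorem pdP_Qc_comp_Phi {n : ℕ} (i j : Fin n) (z : (Fin n → ℝ) × (Fin n → ℝ)) :
    pdP (Qc j ∘ Phi n) i z = 0 := by
  rw [pdP_comp_Phi fun w => (hasFDerivAt_Qc j w).differentiableAt]
  simp [pdP, (hasFDerivAt_Qc j _).fderiv]

theorem pdQ_Pc_comp_Phi {n : ℕ} (i j : Fin n) (z : (Fin n → ℝ) × (Fin n → ℝ)) :
    pdQ (Pc j ∘ Phi n) i z = if i = j then shiftDeriv z.1 j else 0 := by
  rw [pdQ_comp_Phi fun w => (hasFDerivAt_Pc j w).differentiableAt]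
  obtain rfl | hj := eq_or_ne i j
  · simp [pdQ, pdP, (hasFDerivAt_Pc i _).fderiv]
  · simp [pdQ, pdP, (hasFDerivAt_Pc j _).fderiv, hj, hj.symm]

theorem pdP_Pc_comp_Phi {n : ℕ} (i j : Fin n) (z : (Fin n → ℝ) × (Fin n → ℝ)) :
    pdP (Pc j ∘ Phi n) i z = if i = j then 1 else 0 := by
  rw [pdP_comp_Phi fun w => (hasFDerivAt_Pc j w).differentiableAt]
  simp [pdP, (hasFDerivAt_Pc j _).fderiv, Pi.single_apply, eq_comm]

/-- A double sum supported at the two index pairs `(a, b)` and `(b, a)`. -/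
theorem sum_ite_antisymm {n : ℕ} (r : Fin n → Fin n → Prop) [∀ i j, Decidable (r i j)]
    (c : Fin n → Fin n → ℝ) (a b : Fin n) (x y : ℝ) :
    (∑ i, ∑ j, if r i j then c i j * ((if j = a then x else 0) * (if i = b then y else 0) -
      (if i = a then x else 0) * (if j = b then y else 0)) else 0) =
    (if r b a then c b a * (x * y) else 0) - (if r a b then c a b * (x * y) else 0) := by
  have h (i j : Fin n) : (if r i j then c i j * ((if j = a then x else 0) *
      (if i = b then y else 0) - (if i = a then x else 0) * (if j = b then y else 0)) else 0) =
      (if i = b then if j = a then if r b a then c b a * (x * y) else 0 else 0 else 0) -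
      (if i = a then if j = b then if r a b then c a b * (x * y) else 0 else 0 else 0) := by
    split_ifs <;> subst_vars <;> first | contradiction | ring
  simp_rw [h, Finset.sum_sub_distrib]
  simp

theorem todaBr1_Qc_Qc_comp_Phi {n : ℕ} (a b : Fin n) (z : (Fin n → ℝ) × (Fin n → ℝ)) :
    todaBr1 (Qc a ∘ Phi n) (Qc b ∘ Phi n) z =
      (if b < a then 1 else 0) - (if a < b then 1 else 0) := by
  have h := sum_ite_antisymm (fun i j : Fin n => i < j) (fun _ _ => 1) a b 1 1
  simp only [one_mul] at h
  simp only [todaBr1, pdQ_Qc_comp_Phi, pdP_Qc_comp_Phi, h]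
  simp

theorem todaBr1_Qc_Pc_comp_Phi {n : ℕ} (a b : Fin n) (z : (Fin n → ℝ) × (Fin n → ℝ)) :
    todaBr1 (Qc a ∘ Phi n) (Pc b ∘ Phi n) z =
      (if a = b then z.2 b else 0) +
      ((if b < a then shiftDeriv z.1 b else 0) - (if a < b then shiftDeriv z.1 b else 0)) := by
  have h := sum_ite_antisymm (fun i j : Fin n => i < j) (fun _ _ => 1) a b 1 (shiftDeriv z.1 b)
  simp only [one_mul] at h
  simp only [todaBr1, pdQ_Qc_comp_Phi, pdP_Qc_comp_Phi, pdQ_Pc_comp_Phi, pdP_Pc_comp_Phi, h]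
  obtain rfl | hab := eq_or_ne a b
  · simp
  · simp [hab, hab.symm]

theorem todaBr1_Pc_Pc_comp_Phi {n : ℕ} (a b : Fin n) (z : (Fin n → ℝ) × (Fin n → ℝ)) :
    todaBr1 (Pc a ∘ Phi n) (Pc b ∘ Phi n) z =
      ((if (b : ℕ) + 1 = a then Real.exp (z.1 b - z.1 a) else 0) -
        (if (a : ℕ) + 1 = b then Real.exp (z.1 a - z.1 b) else 0)) +
      ((if b < a then shiftDeriv z.1 a * shiftDeriv z.1 b else 0) -
        (if a < b then shiftDeriv z.1 a * shiftDeriv z.1 b else 0)) := by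
  have h := sum_ite_antisymm (fun i j : Fin n => i < j) (fun _ _ => 1) a b
    (shiftDeriv z.1 a) (shiftDeriv z.1 b)
  have h' := sum_ite_antisymm (fun i j : Fin n => (i : ℕ) + 1 = j)
    (fun i j => Real.exp (z.1 i - z.1 j)) a b 1 1
  simp only [one_mul, mul_one] at h h'
  simp only [todaBr1, pdQ_Pc_comp_Phi, pdP_Pc_comp_Phi, h, h']
  rw [Finset.sum_eq_zero, add_zero]
  intro i _
  split_ifs <;> subst_vars <;> ring

theorem bijective_Phi (n : ℕ) : Function.Bijective (Phi n) := by
  refine Function.bijective_iff_has_inverse.2 ⟨fun w => (w.1, fun i => w.2 i -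
    (if (i : ℕ) = 0 then Real.exp (-(w.1 i)) else 0) -
    (if (i : ℕ) = n - 1 then Real.exp (w.1 i) else 0)), fun z => ?_, fun w => ?_⟩
  all_goals
    refine Prod.ext rfl (funext fun i => ?_)
    simp only [Phi]
    ring

theorem todaBr0_comp_Phi {n : ℕ} {F G : (Fin n → ℝ) × (Fin n → ℝ) → ℝ}
    (hF : Differentiable ℝ F) (hG : Differentiable ℝ G) (z : (Fin n → ℝ) × (Fin n → ℝ)) :
    todaBr0 (F ∘ Phi n) (G ∘ Phi n) z = todaBr0 F G (Phi n z) := by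
  simp only [todaBr0, pdQ_comp_Phi hF, pdQ_comp_Phi hG, pdP_comp_Phi hF, pdP_comp_Phi hG]
  exact Finset.sum_congr rfl fun i _ => by ring

theorem shiftDeriv_of_ne {n : ℕ} (q : Fin n → ℝ) {i : Fin n} (h0 : (i : ℕ) ≠ 0)
    (h1 : (i : ℕ) ≠ n - 1) : shiftDeriv q i = 0 := by
  simp [shiftDeriv, h0, h1]

theorem shiftDeriv_first {n : ℕ} (hn : 2 ≤ n) (q : Fin n → ℝ) {i : Fin n} (h : (i : ℕ) = 0) :
    shiftDeriv q i = -Real.exp (-(q i)) := by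
  simp [shiftDeriv, h, show ¬ 0 = n - 1 by omega]

theorem shiftDeriv_last {n : ℕ} (hn : 2 ≤ n) (q : Fin n → ℝ) {i : Fin n} (h : (i : ℕ) = n - 1) :
    shiftDeriv q i = Real.exp (q i) := by
  simp [shiftDeriv, h, show ¬ n - 1 = 0 by omega]

/-!
STATEMENT 12: Φ is a diffeomorphism (in particular a bijection) preserving the canonical
bracket, and the pushforward {F,G}'₁(Φ(z)) := {F∘Φ, G∘Φ}₁(z) of the second Toda bracket
has the same elementary brackets as {.,.}₁ except
{q_i,p_1}'₁ = p₁δ_{i1} − e^{−q₁}, {q_i,p_n}'₁ = p_nδ_{in} − e^{q_n}, {p_1,p_n}'₁ = e^{q_n−q_1}.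
-/
theorem toda_pushforward (n : ℕ) (hn : 3 ≤ n) :
    Function.Bijective (Phi n) ∧
    -- Φ preserves the canonical bracket
    (∀ F G : (Fin n → ℝ) × (Fin n → ℝ) → ℝ, ContDiff ℝ (⊤ : ℕ∞) F → ContDiff ℝ (⊤ : ℕ∞) G →
      ∀ z, todaBr0 (F ∘ Phi n) (G ∘ Phi n) z = todaBr0 F G (Phi n z)) ∧
    -- {q_j, q_i}'₁ = 1 for i < j (unchanged)
    (∀ i j : Fin n, i < j → ∀ z,
      todaBr1 (Qc j ∘ Phi n) (Qc i ∘ Phi n) z = 1) ∧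
    -- {q_i, p_j}'₁ = p_i δ_{ij} for j ∉ {1, n} (unchanged)
    (∀ i j : Fin n, (j : ℕ) ≠ 0 → (j : ℕ) ≠ n - 1 → ∀ z,
      todaBr1 (Qc i ∘ Phi n) (Pc j ∘ Phi n) z =
        if i = j then Pc i (Phi n z) else 0) ∧
    -- {q_i, p_1}'₁ = p_1 δ_{i1} − e^{−q_1}
    (∀ i j : Fin n, (j : ℕ) = 0 → ∀ z,
      todaBr1 (Qc i ∘ Phi n) (Pc j ∘ Phi n) z =
        (if i = j then Pc j (Phi n z) else 0) - Real.exp (-(Qc j (Phi n z)))) ∧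
    -- {q_i, p_n}'₁ = p_n δ_{in} − e^{q_n}
    (∀ i j : Fin n, (j : ℕ) = n - 1 → ∀ z,
      todaBr1 (Qc i ∘ Phi n) (Pc j ∘ Phi n) z =
        (if i = j then Pc j (Phi n z) else 0) - Real.exp (Qc j (Phi n z))) ∧
    -- {p_{i+1}, p_i}'₁ = e^{q_i−q_{i+1}} (unchanged)
    (∀ i j : Fin n, (i : ℕ) + 1 = (j : ℕ) → ∀ z,
      todaBr1 (Pc j ∘ Phi n) (Pc i ∘ Phi n) z =
        Real.exp (Qc i (Phi n z) - Qc j (Phi n z))) ∧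
    -- {p_1, p_n}'₁ = e^{q_n−q_1}
    (∀ i j : Fin n, (i : ℕ) = 0 → (j : ℕ) = n - 1 → ∀ z,
      todaBr1 (Pc i ∘ Phi n) (Pc j ∘ Phi n) z =
        Real.exp (Qc j (Phi n z) - Qc i (Phi n z))) := by
  refine ⟨bijective_Phi n, fun F G hF hG z => todaBr0_comp_Phi (hF.differentiable (by simp))
    (hG.differentiable (by simp)) z, fun i j hij z => ?_, fun i j h0 h1 z => ?_,
    fun i j h0 z => ?_, fun i j h1 z => ?_, fun i j hij z => ?_, fun i j h0 h1 z => ?_⟩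
  · rw [todaBr1_Qc_Qc_comp_Phi, if_pos hij, if_neg hij.not_gt, sub_zero]
  · rw [todaBr1_Qc_Pc_comp_Phi, shiftDeriv_of_ne _ h0 h1]
    obtain rfl | hij := eq_or_ne i j
    · simp [Pc, Phi, h0, h1]
    · simp [hij]
  · rw [todaBr1_Qc_Pc_comp_Phi, shiftDeriv_first (by omega) _ h0]
    obtain rfl | hij := eq_or_ne i j
    · simp [Pc, Qc, Phi, h0, show ¬ 0 = n - 1 by omega]
    · have hlt : j < i := by omega
      simp [Qc, Phi, hij, hlt, hlt.not_gt]
  · rw [todaBr1_Qc_Pc_comp_Phi, shiftDeriv_last (by omega) _ h1]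
    obtain rfl | hij := eq_or_ne i j
    · simp [Pc, Qc, Phi, h1, show ¬ n - 1 = 0 by omega]
    · have hlt : i < j := by omega
      simp [Qc, Phi, hij, hlt, hlt.not_gt]
  · have hzero : shiftDeriv z.1 j * shiftDeriv z.1 i = 0 := by
      by_cases h0 : (i : ℕ) = 0
      · rw [shiftDeriv_of_ne z.1 (i := j) (by omega) (by omega), zero_mul]
      · rw [shiftDeriv_of_ne z.1 (i := i) h0 (by omega), mul_zero]
    simp [todaBr1_Pc_Pc_comp_Phi, hzero, hij, show ¬ (j : ℕ) + 1 = i by omega, Qc, Phi]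
  · rw [todaBr1_Pc_Pc_comp_Phi, shiftDeriv_first (by omega) _ h0,
      shiftDeriv_last (by omega) _ h1, if_neg (by omega), if_neg (by omega), if_neg (by omega),
      if_pos (by omega)]
    simp [Qc, Phi, sub_eq_add_neg, Real.exp_add, mul_comm]


end
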